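/- Assume the involution * of A is nontrivial (there exists a ∈ A with a* ≠ a), A has no zero divisors (ab = 0 implies a = 0 or b = 0), and 2A ≠ 0 (there exists a ∈ A with 2a ≠ 0). Then every involution γ of B = A[X;*]^fl (a K-linear map with γ(γ(p)) = p and γ(pq) = γ(q)γ(p) for all p, q ∈ B) that extends * (γ(a) = a* for all a ∈ A) is equal to α or to β, where α(Σ_i a_i X^i) = Σ_i (−1)^i *^{i+1}(a_i) X^i and β(Σ_i a_i X^i) = Σ_i *^{i+1}(a_i) X^i. -/

import Mathlib

/-- `tau n a b = ab` if `n` is even and `ba` if `n` is odd. -/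
def tau {A : Type*} [NonAssocRing A] (n : ℕ) (a b : A) : A :=
  if Even n then a * b else b * a

/-- The `m`-fold iterate `*^m` of the involution `*`. -/
def starIter {A : Type*} [NonAssocRing A] [StarRing A] : ℕ → A → A
  | 0, a => a
  | m+1, a => star (starIter m a)

/-- The multiplication of the flipped non-associative skew polynomial ring `B = A[X;*]^fl`:
the biadditive extension of `(aX^m)(bX^n) = τ_n(a, *^m(b)) X^{m+n}`. Polynomials are
represented as finitely supported functions `ℕ →₀ A`. -/
noncomputable def fmul {A : Type*} [NonAssocRing A] [StarRing A] (p q : ℕ →₀ A) : ℕ →₀ A :=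
  p.sum fun m a => q.sum fun n b => Finsupp.single (m+n) (tau n a (starIter m b))

/-- The map `α : B → B`, `α(Σ_i a_i X^i) = Σ_i (−1)^i *^{i+1}(a_i) X^i`. -/
noncomputable def alphaMap {A : Type*} [NonAssocRing A] [StarRing A] (p : ℕ →₀ A) : ℕ →₀ A :=
  p.sum fun i a => Finsupp.single i ((-1 : ℤ) ^ i • starIter (i+1) a)

/-- The map `β : B → B`, `β(Σ_i a_i X^i) = Σ_i *^{i+1}(a_i) X^i`. -/
noncomputable def betaMap {A : Type*} [NonAssocRing A] [StarRing A] (p : ℕ →₀ A) : ℕ →₀ A :=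
  p.sum fun i a => Finsupp.single i (starIter (i+1) a)

section FlippedSkewPolynomial

variable {A : Type*} [NonAssocRing A]

theorem tau_add_left (n : ℕ) (a a' b : A) : tau n (a + a') b = tau n a b + tau n a' b := by
  unfold tau
  split_ifs
  · exact add_mul _ _ _
  · exact mul_add _ _ _

theorem tau_add_right (n : ℕ) (a b b' : A) : tau n a (b + b') = tau n a b + tau n a b' := by
  unfold tau
  split_ifs
  · exact mul_add _ _ _
  · exact add_mul _ _ _

@[simp] theorem tau_zero_left (n : ℕ) (b : A) : tau n 0 b = 0 := by simp [tau]

@[simp] theorem tau_zero_right (n : ℕ) (a : A) : tau n a 0 = 0 := by simp [tau]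

@[simp] theorem tau_one_left (n : ℕ) (b : A) : tau n 1 b = b := by simp [tau]

@[simp] theorem tau_one_right (n : ℕ) (a : A) : tau n a 1 = a := by simp [tau]

theorem tau_ne_zero (hnzd : ∀ a b : A, a * b = 0 → a = 0 ∨ b = 0) (n : ℕ) {a b : A}
    (ha : a ≠ 0) (hb : b ≠ 0) : tau n a b ≠ 0 := by
  unfold tau
  split_ifs
  · exact fun h => (hnzd _ _ h).elim ha hb
  · exact fun h => (hnzd _ _ h).elim hb ha

/-- `p` is nonzero of degree `n`. -/
def HasDegree (p : ℕ →₀ A) (n : ℕ) : Prop :=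
  p n ≠ 0 ∧ ∀ k, n < k → p k = 0

theorem HasDegree.unique {p : ℕ →₀ A} {m n : ℕ} (hm : HasDegree p m) (hn : HasDegree p n) :
    m = n := by
  rcases lt_trichotomy m n with h | h | h
  · exact absurd (hm.2 n h) hn.1
  · exact h
  · exact absurd (hn.2 m h) hm.1

theorem HasDegree.single (n : ℕ) {a : A} (ha : a ≠ 0) : HasDegree (Finsupp.single n a) n :=
  ⟨by simpa using ha, fun k hk => by simp [hk.ne]⟩

theorem exists_hasDegree {p : ℕ →₀ A} (hp : p ≠ 0) : ∃ n, HasDegree p n := by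
  have hne : p.support.Nonempty := Finsupp.support_nonempty_iff.2 hp
  refine ⟨p.support.max' hne, Finsupp.mem_support_iff.1 (p.support.max'_mem hne),
    fun k hk => ?_⟩
  by_contra h
  exact absurd (p.support.le_max' k (Finsupp.mem_support_iff.2 h)) (not_le.2 hk)

variable [StarRing A]

@[simp] theorem starIter_zero (m : ℕ) : starIter m (0 : A) = 0 := by
  induction m with
  | zero => rfl
  | succ m ih => simp [starIter, ih]

@[simp] theorem starIter_one (m : ℕ) : starIter m (1 : A) = 1 := by
  induction m with
  | zero => rfl
  | succ m ih => simp [starIter, ih]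

theorem starIter_add (m : ℕ) (a b : A) : starIter m (a + b) = starIter m a + starIter m b := by
  induction m with
  | zero => rfl
  | succ m ih => simp [starIter, ih]

theorem starIter_star (m : ℕ) (a : A) : starIter m (star a) = starIter (m + 1) a := by
  induction m with
  | zero => rfl
  | succ m ih => exact congrArg star ih

theorem starIter_ne_zero (m : ℕ) {a : A} (ha : a ≠ 0) : starIter m a ≠ 0 := by
  induction m with
  | zero => exact ha
  | succ m ih => simpa [starIter] using ih

@[simp] theorem fmul_single_single (m n : ℕ) (a b : A) :
    fmul (Finsupp.single m a) (Finsupp.single n b) =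
      Finsupp.single (m + n) (tau n a (starIter m b)) := by
  simp [fmul]

theorem fmul_add_left (p p' q : ℕ →₀ A) : fmul (p + p') q = fmul p q + fmul p' q := by
  unfold fmul
  refine Finsupp.sum_add_index' (fun m => by simp) fun m a a' => ?_
  simp [tau_add_left, Finsupp.sum_add]

theorem fmul_add_right (p q q' : ℕ →₀ A) : fmul p (q + q') = fmul p q + fmul p q' := by
  unfold fmul
  rw [← Finsupp.sum_add]
  congr 1
  ext1 m
  ext1 a
  exact Finsupp.sum_add_index' (fun n => by simp)
    fun n b b' => by simp [tau_add_right, starIter_add]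

theorem fmul_single_zero_apply (p : ℕ →₀ A) (a : A) (k : ℕ) :
    fmul p (Finsupp.single 0 a) k = p k * starIter k a := by
  induction p using Finsupp.induction_linear with
  | zero => simp [fmul]
  | add p q hp hq => simp [fmul_add_left, hp, hq, add_mul]
  | single m b =>
    rcases eq_or_ne m k with rfl | h
    · simp [tau]
    · simp [h]

theorem single_zero_fmul_apply (p : ℕ →₀ A) (a : A) (k : ℕ) :
    fmul (Finsupp.single 0 a) p k = tau k a (p k) := by
  induction p using Finsupp.induction_linear with
  | zero => simp [fmul]
  | add p q hp hq => simp [fmul_add_right, hp, hq, tau_add_right]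
  | single m b =>
    rcases eq_or_ne m k with rfl | h
    · simp [starIter]
    · simp [h]

theorem HasDegree.fmul_add (hnzd : ∀ a b : A, a * b = 0 → a = 0 ∨ b = 0) {p q : ℕ →₀ A} {m n : ℕ}
    (hp : HasDegree p m) (hq : HasDegree q n) : HasDegree (fmul p q) (m + n) := by
  have hple : ∀ i ∈ p.support, i ≤ m := fun i hi => by
    by_contra h
    exact Finsupp.mem_support_iff.1 hi (hp.2 i (not_le.1 h))
  have hqle : ∀ j ∈ q.support, j ≤ n := fun j hj => by
    by_contra h
    exact Finsupp.mem_support_iff.1 hj (hq.2 j (not_le.1 h))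
  constructor
  · have key : fmul p q (m + n) = tau n (p m) (starIter m (q n)) := by
      simp only [fmul, Finsupp.sum, Finsupp.finsetSum_apply]
      rw [Finset.sum_eq_single m, Finset.sum_eq_single n]
      · simp
      · intro j _ hj
        rw [Finsupp.single_eq_of_ne]
        omega
      · intro h
        exact absurd (Finsupp.notMem_support_iff.1 h) hq.1
      · intro i hi him
        refine Finset.sum_eq_zero fun j hj => ?_
        rw [Finsupp.single_eq_of_ne]
        have := hple i hi
        have := hqle j hj
        omega
      · intro h
        exact absurd (Finsupp.notMem_support_iff.1 h) hp.1
    rw [key]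
    exact tau_ne_zero hnzd n hp.1 (starIter_ne_zero m hq.1)
  · intro k hk
    simp only [fmul, Finsupp.sum, Finsupp.finsetSum_apply]
    refine Finset.sum_eq_zero fun i hi => Finset.sum_eq_zero fun j hj => ?_
    rw [Finsupp.single_eq_of_ne]
    have := hple i hi
    have := hqle j hj
    omega

section Involution

variable {γ : (ℕ →₀ A) →+ (ℕ →₀ A)}

theorem map_single_eq_fmul (hγmul : ∀ p q : ℕ →₀ A, γ (fmul p q) = fmul (γ q) (γ p))
    (hγext : ∀ a : A, γ (Finsupp.single 0 a) = Finsupp.single 0 (star a)) (i : ℕ) (a : A) :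
    γ (Finsupp.single i a) = fmul (γ (Finsupp.single i 1)) (Finsupp.single 0 (star a)) := by
  rw [← hγext, ← hγmul]
  simp

theorem map_single_succ_one (hγmul : ∀ p q : ℕ →₀ A, γ (fmul p q) = fmul (γ q) (γ p)) (i : ℕ) :
    γ (Finsupp.single (i + 1) 1) = fmul (γ (Finsupp.single i 1)) (γ (Finsupp.single 1 1)) := by
  rw [← hγmul]
  simp [add_comm]

theorem hasDegree_map_single (hnzd : ∀ a b : A, a * b = 0 → a = 0 ∨ b = 0) (h1 : (1 : A) ≠ 0)
    (hγmul : ∀ p q : ℕ →₀ A, γ (fmul p q) = fmul (γ q) (γ p))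
    (hγext : ∀ a : A, γ (Finsupp.single 0 a) = Finsupp.single 0 (star a))
    {n : ℕ} (hn : HasDegree (γ (Finsupp.single 1 1)) n) (i : ℕ) {a : A} (ha : a ≠ 0) :
    HasDegree (γ (Finsupp.single i a)) (n * i) := by
  have hpow : HasDegree (γ (Finsupp.single i 1)) (n * i) := by
    induction i with
    | zero => simpa [hγext] using HasDegree.single 0 h1
    | succ i ih =>
      rw [map_single_succ_one hγmul]
      exact ih.fmul_add hnzd hn
  rw [map_single_eq_fmul hγmul hγext]
  exact hpow.fmul_add hnzd (HasDegree.single 0 (star_ne_zero.2 ha))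

theorem HasDegree.map (hnzd : ∀ a b : A, a * b = 0 → a = 0 ∨ b = 0) (h1 : (1 : A) ≠ 0)
    (hγmul : ∀ p q : ℕ →₀ A, γ (fmul p q) = fmul (γ q) (γ p))
    (hγext : ∀ a : A, γ (Finsupp.single 0 a) = Finsupp.single 0 (star a))
    {n : ℕ} (hn : HasDegree (γ (Finsupp.single 1 1)) n) (hn0 : 0 < n) {p : ℕ →₀ A} {m : ℕ}
    (hp : HasDegree p m) : HasDegree (γ p) (n * m) := by
  have hexp : ∀ k, γ p k = ∑ i ∈ p.support, γ (Finsupp.single i (p i)) k := fun k => by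
    conv_lhs => rw [← Finsupp.sum_single p, Finsupp.sum, map_sum, Finsupp.finsetSum_apply]
  have hdeg : ∀ i ∈ p.support, HasDegree (γ (Finsupp.single i (p i))) (n * i) := fun i hi =>
    hasDegree_map_single hnzd h1 hγmul hγext hn i (Finsupp.mem_support_iff.1 hi)
  have hle : ∀ i ∈ p.support, i ≤ m := fun i hi => by
    by_contra h
    exact Finsupp.mem_support_iff.1 hi (hp.2 i (not_le.1 h))
  have hm : m ∈ p.support := Finsupp.mem_support_iff.2 hp.1
  constructor
  · rw [hexp, Finset.sum_eq_single m]
    · exact (hdeg m hm).1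
    · intro i hi him
      exact (hdeg i hi).2 _ (Nat.mul_lt_mul_of_pos_left (lt_of_le_of_ne (hle i hi) him) hn0)
    · exact fun h => absurd hm h
  · intro k hk
    rw [hexp]
    exact Finset.sum_eq_zero fun i hi =>
      (hdeg i hi).2 k ((Nat.mul_le_mul_left n (hle i hi)).trans_lt hk)

theorem hasDegree_map_X (hnzd : ∀ a b : A, a * b = 0 → a = 0 ∨ b = 0) (h1 : (1 : A) ≠ 0)
    (hγinv : ∀ p : ℕ →₀ A, γ (γ p) = p)
    (hγmul : ∀ p q : ℕ →₀ A, γ (fmul p q) = fmul (γ q) (γ p))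
    (hγext : ∀ a : A, γ (Finsupp.single 0 a) = Finsupp.single 0 (star a)) :
    HasDegree (γ (Finsupp.single 1 1)) 1 := by
  have hX : HasDegree (Finsupp.single 1 (1 : A)) 1 := HasDegree.single 1 h1
  have hne : γ (Finsupp.single 1 1) ≠ 0 := fun h => by
    have := hγinv (Finsupp.single 1 1)
    rw [h, map_zero] at this
    exact h1 (Finsupp.single_eq_zero.1 this.symm)
  obtain ⟨n, hn⟩ := exists_hasDegree hne
  rcases Nat.eq_zero_or_pos n with rfl | hpos
  · have hconst : γ (Finsupp.single 1 1) = Finsupp.single 0 (γ (Finsupp.single 1 1) 0) := by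
      ext k
      rcases Nat.eq_zero_or_pos k with rfl | hk
      · simp
      · simp [hn.2 k hk, hk.ne']
    have h := hγinv (Finsupp.single 1 1)
    rw [hconst, hγext] at h
    have h' := DFunLike.congr_fun h 1
    simp only [Finsupp.single_eq_same, Finsupp.single_eq_of_ne one_ne_zero] at h'
    exact absurd h'.symm h1
  · have hsq := HasDegree.map hnzd h1 hγmul hγext hn hpos hn
    rw [hγinv] at hsq
    have : n = 1 := Nat.eq_one_of_mul_eq_one_left (hsq.unique hX)
    exact this ▸ hn

theorem map_X_eq (hnontriv : ∃ a : A, star a ≠ a)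
    (hnzd : ∀ a b : A, a * b = 0 → a = 0 ∨ b = 0) (h2 : ∃ a : A, (2 : ℕ) • a ≠ 0)
    (hγinv : ∀ p : ℕ →₀ A, γ (γ p) = p)
    (hγmul : ∀ p q : ℕ →₀ A, γ (fmul p q) = fmul (γ q) (γ p))
    (hγext : ∀ a : A, γ (Finsupp.single 0 a) = Finsupp.single 0 (star a)) :
    γ (Finsupp.single 1 1) = Finsupp.single 1 (-1) ∨
      γ (Finsupp.single 1 1) = Finsupp.single 1 1 := by
  have htwo : (1 : A) + 1 ≠ 0 := fun h => by
    obtain ⟨a, ha⟩ := h2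
    apply ha
    calc (2 : ℕ) • a = (1 + 1) * a := by rw [two_nsmul, add_mul, one_mul]
      _ = 0 := by rw [h, zero_mul]
  have h1 : (1 : A) ≠ 0 := fun h => htwo (by rw [h, add_zero])
  have hdouble : ∀ a : A, a + a = 0 → a = 0 := fun a ha =>
    (hnzd (1 + 1) a (by rw [add_mul, one_mul, ha])).resolve_left htwo
  have hdeg := hasDegree_map_X hnzd h1 hγinv hγmul hγext
  obtain ⟨c, d, hcd⟩ : ∃ c d : A,
      γ (Finsupp.single 1 1) = Finsupp.single 0 c + Finsupp.single 1 d := by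
    refine ⟨γ (Finsupp.single 1 1) 0, γ (Finsupp.single 1 1) 1, ?_⟩
    ext k
    match k with
    | 0 => simp
    | 1 => simp
    | k + 2 => simp [hdeg.2 (k + 2) (by omega)]
  have hinv := hγinv (Finsupp.single 1 1)
  rw [hcd, map_add, hγext, map_single_eq_fmul hγmul hγext, hcd] at hinv
  have hinv0 : star c + c * star d = 0 := by
    simpa [fmul_single_zero_apply, starIter] using DFunLike.congr_fun hinv 0
  have hinv1 : d * d = 1 := by
    simpa [fmul_single_zero_apply, starIter] using DFunLike.congr_fun hinv 1
  have hd : d = 1 ∨ d = -1 := by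
    have : (d - 1) * (d + 1) = 0 := by
      rw [sub_mul, mul_add, hinv1, mul_one, one_mul]
      abel
    exact (hnzd _ _ this).imp sub_eq_zero.1 eq_neg_of_add_eq_zero_left
  have hcomm : ∀ a : A, star a * c = c * a := fun a => by
    have h : fmul (γ (Finsupp.single 0 a)) (γ (Finsupp.single 1 1)) =
        fmul (γ (Finsupp.single 1 1)) (γ (Finsupp.single 0 (star a))) := by
      rw [← hγmul, ← hγmul]
      simp [starIter]
    rw [hγext, hγext, hcd] at h
    simpa [fmul_single_zero_apply, single_zero_fmul_apply, starIter, tau] using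
      DFunLike.congr_fun h 0
  have hc : c = 0 := by
    by_contra hc
    have hsa : star c = c :=
      sub_eq_zero.1 ((hnzd (star c - c) c (by rw [sub_mul, hcomm, sub_self])).resolve_right hc)
    rcases hd with rfl | rfl
    · rw [star_one, mul_one, hsa] at hinv0
      exact hc (hdouble c hinv0)
    · have hsq : γ (Finsupp.single 2 1) 1 = -(c + c) := by
        rw [map_single_succ_one hγmul 1, hcd]
        simp [fmul_add_left, fmul_add_right, starIter, tau, hsa,
          -Finsupp.single_neg]
      obtain ⟨a, ha⟩ := hnontriv
      have h : fmul (γ (Finsupp.single 0 a)) (γ (Finsupp.single 2 1)) =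
          fmul (γ (Finsupp.single 2 1)) (γ (Finsupp.single 0 a)) := by
        rw [← hγmul, ← hγmul]
        simp [starIter]
      rw [hγext] at h
      have h' : (c + c) * star a = (c + c) * a := by
        have := DFunLike.congr_fun h 1
        rw [fmul_single_zero_apply, single_zero_fmul_apply, hsq] at this
        simpa only [tau, Nat.not_even_one, if_false, starIter, star_star, neg_mul, neg_inj] using
            this
      have h'' : (c + c) * (star a - a) = 0 := by rw [mul_sub, h', sub_self]
      exact (hnzd _ _ h'').elim (fun h => hc (hdouble c h)) fun h => ha (sub_eq_zero.1 h)
  rw [hcd, hc, Finsupp.single_zero, zero_add]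
  exact hd.symm.imp (fun h => by rw [h]) fun h => by rw [h]

theorem map_single_of_map_X (hγmul : ∀ p q : ℕ →₀ A, γ (fmul p q) = fmul (γ q) (γ p))
    (hγext : ∀ a : A, γ (Finsupp.single 0 a) = Finsupp.single 0 (star a)) {e : ℤ}
    (he : γ (Finsupp.single 1 1) = Finsupp.single 1 (e • 1)) (i : ℕ) (a : A) :
    γ (Finsupp.single i a) = Finsupp.single i (e ^ i • starIter (i + 1) a) := by
  have hpow : γ (Finsupp.single i 1) = Finsupp.single i (e ^ i • 1) := by
    induction i with
    | zero => simp [hγext]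
    | succ i ih =>
      rw [map_single_succ_one hγmul, ih, he, fmul_single_single]
      have : starIter i (e • (1 : A)) = e • 1 := by
        clear ih
        induction i with
        | zero => rfl
        | succ i ih => rw [starIter, ih, star_zsmul, star_one]
      rw [this]
      simp only [tau, Nat.not_even_one, if_false, smul_mul_assoc, one_mul, smul_smul, pow_succ']
  rw [map_single_eq_fmul hγmul hγext, hpow, fmul_single_single]
  simp [tau, starIter_star]

theorem map_eq_sum_of_map_X (hγmul : ∀ p q : ℕ →₀ A, γ (fmul p q) = fmul (γ q) (γ p))
    (hγext : ∀ a : A, γ (Finsupp.single 0 a) = Finsupp.single 0 (star a)) {e : ℤ}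
    (he : γ (Finsupp.single 1 1) = Finsupp.single 1 (e • 1)) (p : ℕ →₀ A) :
    γ p = p.sum fun i a => Finsupp.single i (e ^ i • starIter (i + 1) a) := by
  conv_lhs => rw [← Finsupp.sum_single p, Finsupp.sum, map_sum]
  exact Finset.sum_congr rfl fun i _ => map_single_of_map_X hγmul hγext he i _

end Involution

end FlippedSkewPolynomial

/-- if the involution `*` of `A` is nontrivial, `A` has no zero divisors, and
`2A ≠ 0`, then every `K`-linear involution `γ` of `B = A[X;*]^fl` extending `*` equals
`α` or `β`. -/
theorem involution_extending_star_eq_alpha_or_beta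
    {K A : Type*} [CommRing K] [NonAssocRing A] [Module K A]
    [SMulCommClass K A A] [IsScalarTower K A A] [StarRing A]
    (hstar : ∀ (k : K) (a : A), star (k • a) = k • star a)
    (hnontriv : ∃ a : A, star a ≠ a)
    (hnzd : ∀ a b : A, a * b = 0 → a = 0 ∨ b = 0)
    (h2 : ∃ a : A, (2 : ℕ) • a ≠ 0)
    (γ : (ℕ →₀ A) →ₗ[K] (ℕ →₀ A))
    (hγinv : ∀ p : ℕ →₀ A, γ (γ p) = p)
    (hγmul : ∀ p q : ℕ →₀ A, γ (fmul p q) = fmul (γ q) (γ p))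
    (hγext : ∀ a : A, γ (Finsupp.single 0 a) = Finsupp.single 0 (star a)) :
    (⇑γ = fun p : ℕ →₀ A => alphaMap p) ∨ (⇑γ = fun p : ℕ →₀ A => betaMap p) := by
  have hmul : ∀ p q, γ.toAddMonoidHom (fmul p q) =
      fmul (γ.toAddMonoidHom q) (γ.toAddMonoidHom p) := hγmul
  refine (map_X_eq (γ := γ.toAddMonoidHom) hnontriv hnzd h2 hγinv hmul hγext).imp
    (fun h => funext fun p => ?_) (fun h => funext fun p => ?_)
  · exact map_eq_sum_of_map_X hmul hγext (e := -1) (by simpa using h) p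
  · have := map_eq_sum_of_map_X hmul hγext (e := 1) (by simpa using h) p
    simpa [betaMap] using this
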